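/- For every j ≥ 0 and z ∈ ℝ, the set D̲^z_{≪j} of functions z·id + ξ' with ξ' a piecewise constant càdlàg function on [0,1] having strictly fewer than j discontinuities (counting a jump at 0 if ξ'(0) ≠ 0) is closed in (D[0,1], d_{M_1'}). -/

import Mathlib

open Set Filter Topology

noncomputable section

/-- `ξ(t⁻)` with the convention `ξ(0⁻) = 0`. -/
def leftVal (ξ : ℝ → ℝ) (t : ℝ) : ℝ := if t = 0 then 0 else Function.leftLim ξ t

/-- A càdlàg function on `[0,1]`: right-continuous on `[0,1)` with left limits on `(0,1]`. -/
def IsCadlag (ξ : ℝ → ℝ) : Prop :=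
  (∀ t ∈ Ico (0:ℝ) 1, Tendsto ξ (nhdsWithin t (Ioi t)) (nhds (ξ t))) ∧
  (∀ t ∈ Ioc (0:ℝ) 1, ∃ l : ℝ, Tendsto ξ (nhdsWithin t (Iio t)) (nhds l))

/-- The extended completed graph `Γ'_ξ` of `ξ` (with `ξ(0⁻) = 0`). -/
def extGraph (ξ : ℝ → ℝ) : Set (ℝ × ℝ) :=
  {p | p.2 ∈ Icc (0:ℝ) 1 ∧
    p.1 ∈ Icc (min (leftVal ξ p.2) (ξ p.2)) (max (leftVal ξ p.2) (ξ p.2))}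

/-- `(u, v)` is a parametric representation of `ξ`: a continuous map of `[0,1]` onto `Γ'_ξ`
which is nondecreasing for the order on the graph. -/
def ParamRep (ξ u v : ℝ → ℝ) : Prop :=
  ContinuousOn u (Icc 0 1) ∧ ContinuousOn v (Icc 0 1) ∧
  (fun s => (u s, v s)) '' Icc (0:ℝ) 1 = extGraph ξ ∧
  ∀ s₁ ∈ Icc (0:ℝ) 1, ∀ s₂ ∈ Icc (0:ℝ) 1, s₁ ≤ s₂ →
    v s₁ < v s₂ ∨ (v s₁ = v s₂ ∧ |leftVal ξ (v s₁) - u s₁| ≤ |leftVal ξ (v s₂) - u s₂|)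

/-- The `M₁'` metric on `D[0,1]`. -/
def dM1 (ξ ζ : ℝ → ℝ) : ℝ :=
  sInf { r | ∃ u₁ v₁ u₂ v₂ : ℝ → ℝ, ParamRep ξ u₁ v₁ ∧ ParamRep ζ u₂ v₂ ∧
    r = max (⨆ s : Icc (0:ℝ) 1, |u₁ s - u₂ s|) (⨆ s : Icc (0:ℝ) 1, |v₁ s - v₂ s|) }

/-- The Skorokhod `J₁` metric on `D[0,1]`. -/
def dJ1 (ξ ζ : ℝ → ℝ) : ℝ :=
  sInf { r | ∃ lam : ℝ → ℝ, ContinuousOn lam (Icc 0 1) ∧ StrictMonoOn lam (Icc 0 1) ∧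
    lam '' Icc (0:ℝ) 1 = Icc (0:ℝ) 1 ∧
    r = max (⨆ s : Icc (0:ℝ) 1, |lam s - (s:ℝ)|) (⨆ s : Icc (0:ℝ) 1, |ξ (lam s) - ζ s|) }

/-- The set of discontinuities of `ξ` in `[0,1]` (with `ξ(0⁻) = 0`). -/
def Disc (ξ : ℝ → ℝ) : Set ℝ := {t ∈ Icc (0:ℝ) 1 | ξ t ≠ leftVal ξ t}

end

noncomputable section

open Set

/-- `ξ` is piecewise constant on `[0,1]`: there are `0 = t₀ < t₁ < ⋯ < t_m = 1` with `ξ`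
constant on each `[t_{i-1}, t_i)`. -/
def PiecewiseConstant (ξ : ℝ → ℝ) : Prop :=
  ∃ (m : ℕ) (t : ℕ → ℝ), 0 < m ∧ t 0 = 0 ∧ t m = 1 ∧ (∀ i < m, t i < t (i + 1)) ∧
    ∀ i < m, ∀ s₁ ∈ Ico (t i) (t (i + 1)), ∀ s₂ ∈ Ico (t i) (t (i + 1)), ξ s₁ = ξ s₂

/-- `D̲_{≤ j}`: nondecreasing piecewise constant functions with at most `j` discontinuities
(a nonzero value at `0` counts as a jump, via the convention `ξ(0⁻) = 0`). -/
def Dle (j : ℕ) : Set (ℝ → ℝ) :=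
  {ξ | PiecewiseConstant ξ ∧ MonotoneOn ξ (Icc 0 1) ∧ 0 ≤ ξ 0 ∧
    (Disc ξ).Finite ∧ (Disc ξ).ncard ≤ j}

/-- `D̲^z_{≤ j} = {z·id + ξ' : ξ' ∈ D̲_{≤ j}}`. -/
def DleZ (z : ℝ) (j : ℕ) : Set (ℝ → ℝ) :=
  {ξ | ∃ ξ' ∈ Dle j, ξ = fun t => z * t + ξ' t}

/-- `D̲_{≪ j}`: piecewise constant functions with strictly fewer than `j` discontinuities. -/
def Dll (j : ℕ) : Set (ℝ → ℝ) :=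
  {ξ | PiecewiseConstant ξ ∧ (Disc ξ).Finite ∧ (Disc ξ).ncard < j}

/-- `D̲^z_{≪ j} = {z·id + ξ' : ξ' ∈ D̲_{≪ j}}`. -/
def DllZ (z : ℝ) (j : ℕ) : Set (ℝ → ℝ) :=
  {ξ | ∃ ξ' ∈ Dll j, ξ = fun t => z * t + ξ' t}

end

/-- Functions on the whole line that are right-continuous with left limits. -/
structure RCLL (g : ℝ → ℝ) : Prop where
  right : ∀ t, Tendsto g (𝓝[>] t) (𝓝 (g t))
  left : ∀ t, Tendsto g (𝓝[<] t) (𝓝 (Function.leftLim g t))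

/-- The extension of a function on `[0,1]` by `0` to the left and by its last value to the right. -/
noncomputable def extend (f : ℝ → ℝ) (t : ℝ) : ℝ := if t < 0 then 0 else if t ≤ 1 then f t else f 1

lemma extend_of_neg (f : ℝ → ℝ) {t : ℝ} (ht : t < 0) : extend f t = 0 := by simp [extend, ht]

lemma extend_of_mem (f : ℝ → ℝ) {t : ℝ} (ht : t ∈ Icc (0 : ℝ) 1) : extend f t = f t := by
  simp [extend, not_lt.2 ht.1, ht.2]

lemma extend_of_one_lt (f : ℝ → ℝ) {t : ℝ} (ht : 1 < t) : extend f t = f 1 := by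
  simp [extend, not_lt.2 (zero_le_one.trans ht.le), ht]

lemma eventuallyEq_extend_left (f : ℝ → ℝ) {t : ℝ} (ht : t ∈ Ioc (0 : ℝ) 1) :
    f =ᶠ[𝓝[<] t] extend f := by
  filter_upwards [Ioo_mem_nhdsLT ht.1] with x hx
  exact (extend_of_mem f ⟨hx.1.le, hx.2.le.trans ht.2⟩).symm

lemma tendsto_extend_zero (f : ℝ → ℝ) : Tendsto (extend f) (𝓝[<] 0) (𝓝 0) := by
  refine tendsto_const_nhds.congr' ?_
  filter_upwards [self_mem_nhdsWithin] with x hx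
  exact (extend_of_neg f hx).symm

lemma IsCadlag.rcll_extend {f : ℝ → ℝ} (hf : IsCadlag f) : RCLL (extend f) where
  right t := by
    rcases lt_or_ge t 0 with h | h
    · rw [extend_of_neg f h]
      refine tendsto_const_nhds.congr' ?_
      filter_upwards [Ioo_mem_nhdsGT h] with x hx
      exact (extend_of_neg f hx.2).symm
    rcases lt_or_ge t 1 with h1 | h1
    · rw [extend_of_mem f ⟨h, h1.le⟩]
      refine (hf.1 t ⟨h, h1⟩).congr' ?_
      filter_upwards [Ioo_mem_nhdsGT h1] with x hx
      exact (extend_of_mem f ⟨h.trans hx.1.le, hx.2.le⟩).symm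
    · have : extend f t = f 1 := by
        rcases h1.eq_or_lt with rfl | h1
        · exact extend_of_mem f ⟨zero_le_one, le_rfl⟩
        · exact extend_of_one_lt f h1
      rw [this]
      refine tendsto_const_nhds.congr' ?_
      filter_upwards [self_mem_nhdsWithin] with x hx
      exact (extend_of_one_lt f (h1.trans_lt hx)).symm
  left t := by
    refine tendsto_leftLim_of_tendsto ?_
    rcases le_or_gt t 0 with h | h
    · refine ⟨0, tendsto_const_nhds.congr' ?_⟩
      filter_upwards [self_mem_nhdsWithin] with x hx
      exact (extend_of_neg f (lt_of_lt_of_le hx h)).symm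
    rcases le_or_gt t 1 with h1 | h1
    · obtain ⟨l, hl⟩ := hf.2 t ⟨h, h1⟩
      exact ⟨l, hl.congr' (eventuallyEq_extend_left f ⟨h, h1⟩)⟩
    · refine ⟨f 1, tendsto_const_nhds.congr' ?_⟩
      filter_upwards [Ioo_mem_nhdsLT h1] with x hx
      exact (extend_of_one_lt f hx.1).symm

lemma IsCadlag.leftVal_eq {f : ℝ → ℝ} (hf : IsCadlag f) {t : ℝ} (ht : t ∈ Icc (0 : ℝ) 1) :
    leftVal f t = Function.leftLim (extend f) t := by
  rcases ht.1.eq_or_lt with rfl | h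
  · simp [leftVal, leftLim_eq_of_tendsto (tendsto_extend_zero f)]
  · obtain ⟨l, hl⟩ := hf.2 t ⟨h, ht.2⟩
    rw [leftVal, if_neg h.ne', leftLim_eq_of_tendsto hl,
      leftLim_eq_of_tendsto (hl.congr' (eventuallyEq_extend_left f ⟨h, ht.2⟩))]

lemma countable_left_jumps {g : ℝ → ℝ}
    (hg : ∀ t, Tendsto g (𝓝[<] t) (𝓝 (Function.leftLim g t))) :
    {t | g t ≠ Function.leftLim g t}.Countable := by
  have h1 (T : Set ℝ) : {x ∈ T | ∃ z, z < g x ∧ ∀ y ∈ T, y < x → g y ≤ z}.Countable :=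
    countable_image_gt_image_Ioi_within (β := ℝᵒᵈ) T g
  have h2 (T : Set ℝ) : {x ∈ T | ∃ z, g x < z ∧ ∀ y ∈ T, y < x → z ≤ g y}.Countable :=
    countable_image_lt_image_Ioi_within (β := ℝᵒᵈ) T g
  refine ((countable_iUnion fun q : ℚ => h1 (Ioi (q : ℝ))).union
    (countable_iUnion fun q : ℚ => h2 (Ioi (q : ℝ)))).mono fun x hx => ?_
  rcases lt_or_gt_of_ne (show g x ≠ Function.leftLim g x from hx) with h | h
  · right
    obtain ⟨z, hz1, hz2⟩ := exists_between h
    obtain ⟨a, ha, ha'⟩ := mem_nhdsLT_iff_exists_Ioo_subset.1 ((hg x).eventually (Ioi_mem_nhds hz2))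
    obtain ⟨q, hq1, hq2⟩ := exists_rat_btwn (show a < x from ha)
    exact mem_iUnion.2 ⟨q, hq2, z, hz1, fun y hy hyx => le_of_lt (ha' ⟨hq1.trans hy, hyx⟩)⟩
  · left
    obtain ⟨z, hz1, hz2⟩ := exists_between h
    obtain ⟨a, ha, ha'⟩ := mem_nhdsLT_iff_exists_Ioo_subset.1 ((hg x).eventually (Iio_mem_nhds hz1))
    obtain ⟨q, hq1, hq2⟩ := exists_rat_btwn (show a < x from ha)
    exact mem_iUnion.2 ⟨q, hq2, z, hz2, fun y hy hyx => le_of_lt (ha' ⟨hq1.trans hy, hyx⟩)⟩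

/-- Any countable set of points can be made to be jumps of an increasing expanding function. -/
lemma exists_expanding_with_jumps {D : Set ℝ} (hD : D.Countable) :
    ∃ H : ℝ → ℝ, (∀ x y, x ≤ y → y - x ≤ H y - H x) ∧
      ∀ t ∈ D, ∃ w > 0, ∀ s < t, H s + w ≤ H t := by
  classical
  have : Countable D := hD.to_subtype
  have : Encodable D := Encodable.ofCountable D
  obtain ⟨w, hw, c, hc, -⟩ := posSumOfEncodable one_pos D
  have hs : ∀ t : ℝ, Summable fun d : D => if (d : ℝ) ≤ t then w d else 0 := fun t =>
    Summable.of_nonneg_of_le (fun d => by split_ifs <;> simp [(hw d).le])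
      (fun d => by split_ifs <;> simp [(hw d).le]) hc.summable
  refine ⟨fun t => t + ∑' d : D, if (d : ℝ) ≤ t then w d else 0, fun x y hxy => ?_, fun t ht => ?_⟩
  · have : (∑' d : D, if (d : ℝ) ≤ x then w d else 0) ≤ ∑' d : D, if (d : ℝ) ≤ y then w d else 0 := by
      refine (hs x).tsum_le_tsum (fun d => ?_) (hs y)
      by_cases h : (d : ℝ) ≤ x
      · simp [h, h.trans hxy]
      · simp only [h, if_false]
        split_ifs <;> simp [(hw d).le]
    dsimp only
    linarith
  · refine ⟨w ⟨t, ht⟩, hw _, fun s hst => ?_⟩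
    have h1 := (hs s).hasSum.add (hasSum_ite_eq (⟨t, ht⟩ : D) (w ⟨t, ht⟩))
    have := hasSum_le (fun d => ?_) h1 (hs t).hasSum
    · dsimp only
      linarith
    · by_cases hd : d = ⟨t, ht⟩
      · subst hd
        simp [not_le.2 hst]
      · by_cases h : (d : ℝ) ≤ s
        · simp [hd, h, h.trans hst.le]
        · simp only [hd, h, if_false, add_zero]
          split_ifs <;> simp [(hw d).le]

lemma RCLL.exists_clock {g : ℝ → ℝ} (hg : RCLL g) :
    ∃ H : ℝ → ℝ, (∀ x y, x ≤ y → y - x ≤ H y - H x) ∧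
      ∀ t, g t ≠ Function.leftLim g t → Function.leftLim H t < Function.rightLim H t := by
  obtain ⟨H, hH, hj⟩ := exists_expanding_with_jumps (countable_left_jumps hg.left)
  have hm : Monotone H := fun x y hxy => by linarith [hH x y hxy]
  refine ⟨H, hH, fun t ht => ?_⟩
  obtain ⟨w, hw, h⟩ := hj t ht
  have : Function.leftLim H t ≤ H t - w := by
    refine le_of_tendsto (hm.tendsto_leftLim t) ?_
    filter_upwards [self_mem_nhdsWithin] with s hs
    linarith [h s hs]
  linarith [hm.le_rightLim (le_refl t)]

lemma RCLL.leftLim_mem {g : ℝ → ℝ} (hg : RCLL g) {C : Set ℝ} (hC : IsClosed C) {a b : ℝ}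
    (h : ∀ x ∈ Ioo a b, g x ∈ C) {t : ℝ} (ht : t ∈ Ioc a b) : Function.leftLim g t ∈ C := by
  refine hC.mem_of_tendsto (hg.left t) ?_
  filter_upwards [Ioo_mem_nhdsLT ht.1] with x hx
  exact h x ⟨hx.1, hx.2.trans_le ht.2⟩

lemma RCLL.uIcc_subset {g : ℝ → ℝ} (hg : RCLL g) {c d a b : ℝ}
    (h : ∀ x ∈ Ioo a b, g x ∈ Icc c d) {t : ℝ} (ht : t ∈ Ioo a b) :
    uIcc (Function.leftLim g t) (g t) ⊆ Icc c d :=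
  uIcc_subset_Icc (hg.leftLim_mem isClosed_Icc h ⟨ht.1, ht.2.le⟩) (h t ht)

lemma RCLL.exists_right {g : ℝ → ℝ} (hg : RCLL g) (t : ℝ) {ε : ℝ} (hε : 0 < ε) :
    ∃ h > 0, ∀ x ∈ Ioo t (t + h), g x ∈ Icc (g t - ε) (g t + ε) := by
  obtain ⟨b, hb, hb'⟩ := mem_nhdsGT_iff_exists_Ioo_subset.1
    ((hg.right t).eventually (Icc_mem_nhds (sub_lt_self _ hε) (lt_add_of_pos_right _ hε)))
  exact ⟨b - t, sub_pos.2 hb, fun x hx => hb' (by simpa using hx)⟩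

lemma RCLL.exists_left {g : ℝ → ℝ} (hg : RCLL g) (t : ℝ) {ε : ℝ} (hε : 0 < ε) :
    ∃ h > 0, ∀ x ∈ Ioo (t - h) t,
      g x ∈ Icc (Function.leftLim g t - ε) (Function.leftLim g t + ε) := by
  obtain ⟨b, hb, hb'⟩ := mem_nhdsLT_iff_exists_Ioo_subset.1
    ((hg.left t).eventually (Icc_mem_nhds (sub_lt_self _ hε) (lt_add_of_pos_right _ hε)))
  exact ⟨t - b, sub_pos.2 hb, fun x hx => hb' (by simpa using hx)⟩

section Clock

variable {H : ℝ → ℝ}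

lemma monotone_of_expanding (hH : ∀ x y, x ≤ y → y - x ≤ H y - H x) : Monotone H :=
  fun x y hxy => by linarith [hH x y hxy]

lemma gap_of_expanding (hH : ∀ x y, x ≤ y → y - x ≤ H y - H x) {t t' : ℝ} (h : t < t') :
    t' - t ≤ Function.leftLim H t' - Function.rightLim H t := by
  have hm := monotone_of_expanding hH
  refine le_of_forall_pos_le_add fun ε hε => ?_
  set e := min (ε / 2) ((t' - t) / 2) with he
  have he0 : 0 < e := lt_min (by linarith) (by linarith)
  have he1 : e ≤ ε / 2 := min_le_left _ _
  have he2 : e ≤ (t' - t) / 2 := min_le_right _ _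
  have h1 := hm.rightLim_le (show t < t + e by linarith)
  have h2 := hm.le_leftLim (show t' - e < t' by linarith)
  have h3 := hH (t + e) (t' - e) (by linarith)
  linarith

lemma exists_clock_time (hm : Monotone H) {s : ℝ}
    (hs : s ∈ Icc (Function.leftLim H 0) (Function.rightLim H 1)) :
    ∃ t ∈ Icc (0 : ℝ) 1, s ∈ Icc (Function.leftLim H t) (Function.rightLim H t) := by
  set T := {t ∈ Icc (0 : ℝ) 1 | Function.leftLim H t ≤ s} with hT
  have h0 : (0 : ℝ) ∈ T := ⟨⟨le_rfl, zero_le_one⟩, hs.1⟩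
  have hb : BddAbove T := ⟨1, fun t ht => ht.1.2⟩
  have ht0 : 0 ≤ sSup T := le_csSup hb h0
  have ht1 : sSup T ≤ 1 := csSup_le ⟨0, h0⟩ fun t ht => ht.1.2
  refine ⟨sSup T, ⟨ht0, ht1⟩, ?_, ?_⟩
  · refine le_of_tendsto (hm.tendsto_leftLim _) ?_
    filter_upwards [self_mem_nhdsWithin] with y hy
    obtain ⟨t', ht', hyt'⟩ := exists_lt_of_lt_csSup ⟨0, h0⟩ hy
    exact (hm.le_leftLim hyt').trans ht'.2
  · rcases ht1.eq_or_lt with h1 | h1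
    · rw [h1]; exact hs.2
    refine ge_of_tendsto (hm.tendsto_rightLim _) ?_
    filter_upwards [Ioo_mem_nhdsGT h1] with y hy
    have : y ∉ T := fun h => absurd (le_csSup hb h) (not_le.2 hy.1)
    have : s < Function.leftLim H y := by
      by_contra! h
      exact this ⟨⟨ht0.trans hy.1.le, hy.2.le⟩, h⟩
    exact this.le.trans (hm.leftLim_le le_rfl)

end Clock

lemma IsCadlag.exists_paramRep {f : ℝ → ℝ} (hf : IsCadlag f) : ∃ u v, ParamRep f u v := by
  set g := extend f with hgdef
  have hg : RCLL g := hf.rcll_extend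
  obtain ⟨H, hH, hjump⟩ := hg.exists_clock
  have hm := monotone_of_expanding hH
  set A := Function.leftLim H with hA
  set B := Function.rightLim H with hB
  set L := Function.leftLim g with hL
  have hAB : ∀ t, A t ≤ B t := fun t => hm.leftLim_le_rightLim le_rfl
  set I := Icc (A 0) (B 1) with hI
  choose! τ hτ hτs using fun s => exists_clock_time (H := H) hm (s := s)
  have hle : ∀ s ∈ I, ∀ s' ∈ I, τ s < τ s' → τ s' - τ s ≤ s' - s := fun s hs s' hs' h => by
    linarith [gap_of_expanding hH h, (hτs s hs).2, (hτs s' hs').1]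
  have hτmono : ∀ s ∈ I, ∀ s' ∈ I, s ≤ s' → τ s ≤ τ s' := fun s hs s' hs' h => by
    by_contra! h'
    linarith [hle s' hs' s hs h']
  have hτlip : ∀ s ∈ I, ∀ s' ∈ I, |τ s - τ s'| ≤ |s - s'| := fun s hs s' hs' => by
    rcases lt_trichotomy (τ s) (τ s') with h | h | h
    · rw [abs_sub_comm, abs_sub_comm s, abs_of_pos (sub_pos.2 h)]
      exact (hle s hs s' hs' h).trans (le_abs_self _)
    · simp [h]
    · rw [abs_of_pos (sub_pos.2 h)]
      exact (hle s' hs' s hs h).trans (le_abs_self _)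
  have hτeq : ∀ t ∈ Icc (0 : ℝ) 1, ∀ s ∈ Icc (A t) (B t), s ∈ I ∧ τ s = t := by
    intro t ht s hs
    have hsI : s ∈ I := ⟨(hm.leftLim ht.1).trans hs.1, hs.2.trans (hm.rightLim ht.2)⟩
    refine ⟨hsI, ?_⟩
    rcases lt_trichotomy (τ s) t with h | h | h
    · linarith [gap_of_expanding hH h, (hτs s hsI).2, hs.1]
    · exact h
    · linarith [gap_of_expanding hH h, (hτs s hsI).1, hs.2]
  -- the spatial component interpolates linearly across each jump
  set θ : ℝ → ℝ := fun s => (s - A (τ s)) / (B (τ s) - A (τ s)) with hθ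
  set U : ℝ → ℝ := fun s => L (τ s) + θ s * (g (τ s) - L (τ s)) with hU
  have hθ01 : ∀ s ∈ I, θ s ∈ Icc (0 : ℝ) 1 := fun s hs =>
    ⟨div_nonneg (sub_nonneg.2 (hτs s hs).1) (sub_nonneg.2 (hAB _)),
      div_le_one_of_le₀ (sub_le_sub_right (hτs s hs).2 _) (sub_nonneg.2 (hAB _))⟩
  have hUmem : ∀ s ∈ I, U s ∈ uIcc (L (τ s)) (g (τ s)) := fun s hs => by
    rw [← segment_eq_uIcc, segment_eq_image']
    exact ⟨θ s, hθ01 s hs, by simp [hU]⟩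
  have hUB : ∀ t ∈ Icc (0 : ℝ) 1, U (B t) = g t := fun t ht => by
    have h := (hτeq t ht (B t) ⟨hAB t, le_rfl⟩).2
    simp only [hU, hθ, h]
    by_cases hj : g t = L t
    · simp [hj]
    · rw [div_self (sub_pos.2 (hjump t hj)).ne']; ring
  have hUA : ∀ t ∈ Icc (0 : ℝ) 1, U (A t) = L t := fun t ht => by
    have h := (hτeq t ht (A t) ⟨le_rfl, hAB t⟩).2
    simp [hU, hθ, h]
  have hUcont : ContinuousOn U I := by
    intro s₀ hs₀
    set t := τ s₀ with ht
    set C := |g t - L t| / (B t - A t) with hC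
    have hC0 : 0 ≤ C := div_nonneg (abs_nonneg _) (sub_nonneg.2 (hAB _))
    have hsame : ∀ s, τ s = t → |U s - U s₀| ≤ C * |s - s₀| := fun s hs => by
      have : U s - U s₀ = (g t - L t) / (B t - A t) * (s - s₀) := by
        simp only [hU, hθ, hs, ← ht]; ring
      rw [this, abs_mul, abs_div, abs_of_nonneg (sub_nonneg.2 (hAB t))]
    rw [Metric.continuousWithinAt_iff]
    intro ε hε
    obtain ⟨h₁, hh₁, hr⟩ := hg.exists_right t (half_pos (half_pos hε))
    obtain ⟨h₂, hh₂, hl⟩ := hg.exists_left t (half_pos (half_pos hε))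
    refine ⟨min (min h₁ h₂) (ε / 2 / (C + 1)), by positivity, fun s hs hd => ?_⟩
    rw [Real.dist_eq] at hd ⊢
    have hd1 : |s - s₀| < h₁ := hd.trans_le ((min_le_left _ _).trans (min_le_left _ _))
    have hd2 : |s - s₀| < h₂ := hd.trans_le ((min_le_left _ _).trans (min_le_right _ _))
    have hd3 : C * |s - s₀| < ε / 2 := by
      have := hd.trans_le (min_le_right _ _)
      rw [lt_div_iff₀ (by linarith)] at this
      nlinarith [abs_nonneg (s - s₀)]
    have hlip := hτlip s hs s₀ hs₀
    rw [← ht] at hlip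
    rcases lt_trichotomy (τ s) t with h | h | h
    · have hA₁ : s ≤ A t := by linarith [gap_of_expanding hH h, (hτs s hs).2]
      have hA₂ : |U (A t) - U s₀| ≤ C * |s - s₀| := by
        refine (hsame _ (hτeq t (hτ s₀ hs₀) (A t) ⟨le_rfl, hAB t⟩).2).trans ?_
        refine mul_le_mul_of_nonneg_left ?_ hC0
        have := (hτs s₀ hs₀).1
        rw [abs_of_nonpos (by linarith), abs_of_nonpos (by linarith)]
        linarith
      rw [hUA t (hτ s₀ hs₀)] at hA₂
      rw [abs_of_neg (by linarith)] at hlip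
      have := hg.uIcc_subset hl (t := τ s) ⟨by linarith, h⟩ (hUmem s hs)
      have h3 : |U s - L t| ≤ ε / 2 / 2 := abs_le.2 ⟨by linarith [this.1], by linarith [this.2]⟩
      linarith [abs_sub_le (U s) (L t) (U s₀)]
    · linarith [hsame s h]
    · have hA₁ : B t ≤ s := by linarith [gap_of_expanding hH h, (hτs s hs).1]
      have hA₂ : |U (B t) - U s₀| ≤ C * |s - s₀| := by
        refine (hsame _ (hτeq t (hτ s₀ hs₀) (B t) ⟨hAB t, le_rfl⟩).2).trans ?_
        refine mul_le_mul_of_nonneg_left ?_ hC0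
        have := (hτs s₀ hs₀).2
        rw [abs_of_nonneg (by linarith), abs_of_nonneg (by linarith)]
        linarith
      rw [hUB t (hτ s₀ hs₀)] at hA₂
      rw [abs_of_pos (by linarith)] at hlip
      have := hg.uIcc_subset hr (t := τ s) ⟨h, by linarith⟩ (hUmem s hs)
      have h3 : |U s - g t| ≤ ε / 2 / 2 := abs_le.2 ⟨by linarith [this.1], by linarith [this.2]⟩
      linarith [abs_sub_le (U s) (g t) (U s₀)]
  have hτcont : ContinuousOn τ I := by
    refine (LipschitzOnWith.of_dist_le_mul (K := 1) fun s hs s' hs' => ?_).continuousOn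
    simpa [Real.dist_eq] using hτlip s hs s' hs'
  have hlen : 0 < B 1 - A 0 := by
    have := gap_of_expanding hH zero_lt_one
    linarith [hAB 0, hAB 1]
  set σ : ℝ → ℝ := fun r => A 0 + r * (B 1 - A 0) with hσ
  have hσI : MapsTo σ (Icc 0 1) I := fun r hr =>
    ⟨by simp only [hσ]; nlinarith [hr.1], by simp only [hσ]; nlinarith [hr.2]⟩
  have hσc : ContinuousOn σ (Icc 0 1) := by fun_prop
  have hσsurj : ∀ s ∈ I, ∃ r ∈ Icc (0 : ℝ) 1, σ r = s := fun s hs =>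
    ⟨(s - A 0) / (B 1 - A 0), ⟨div_nonneg (sub_nonneg.2 hs.1) hlen.le,
      div_le_one_of_le₀ (sub_le_sub_right hs.2 _) hlen.le⟩, by
        simp only [hσ]; field_simp; ring⟩
  refine ⟨fun r => U (σ r), fun r => τ (σ r), hUcont.comp hσc hσI, hτcont.comp hσc hσI, ?_, ?_⟩
  · ext ⟨x, t⟩
    constructor
    · rintro ⟨r, hr, hrx⟩
      obtain ⟨rfl, rfl⟩ := Prod.mk.inj hrx
      have h1 := hτ _ (hσI hr)
      refine ⟨h1, ?_⟩
      simp only [hf.leftVal_eq h1, ← extend_of_mem f h1]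
      exact hUmem _ (hσI hr)
    · rintro ⟨ht, hx⟩
      simp only at ht hx
      simp only [hf.leftVal_eq ht] at hx
      rw [← extend_of_mem f ht] at hx
      change x ∈ uIcc (L t) (g t) at hx
      rw [← segment_eq_uIcc, segment_eq_image'] at hx
      obtain ⟨c, hc, hcx⟩ := hx
      have hcs : A t + c * (B t - A t) ∈ Icc (A t) (B t) :=
        ⟨by nlinarith [hc.1, hAB t], by nlinarith [hc.2, hAB t]⟩
      obtain ⟨hsI, hst⟩ := hτeq t ht _ hcs
      obtain ⟨r, hr, hrs⟩ := hσsurj _ hsI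
      refine ⟨r, hr, ?_⟩
      simp only [hrs, hst, Prod.mk.injEq, and_true]
      rw [← hcx]
      simp only [hU, hθ, hst, smul_eq_mul, add_sub_cancel_left]
      by_cases hj : g t = L t
      · simp [hj]
      · rw [mul_div_cancel_right₀ _ (sub_pos.2 (hjump t hj)).ne']
  · intro r hr r' hr' hrr'
    have hσσ : σ r ≤ σ r' := by simp only [hσ]; nlinarith
    rcases (hτmono _ (hσI hr) _ (hσI hr') hσσ).lt_or_eq with h | h
    · exact Or.inl h
    · refine Or.inr ⟨h, ?_⟩
      have key : ∀ r ∈ Icc (0 : ℝ) 1, |leftVal f (τ (σ r)) - U (σ r)| =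
          θ (σ r) * |g (τ (σ r)) - L (τ (σ r))| := fun r hr => by
        rw [hf.leftVal_eq (hτ _ (hσI hr)), ← hgdef, ← hL, abs_sub_comm]
        simp only [hU, add_sub_cancel_left]
        rw [abs_mul, abs_of_nonneg (hθ01 _ (hσI hr)).1]
      rw [key r hr, key r' hr', ← h]
      refine mul_le_mul_of_nonneg_right ?_ (abs_nonneg _)
      simp only [hθ, ← h]
      exact div_le_div_of_nonneg_right (sub_le_sub_right hσσ _) (sub_nonneg.2 (hAB _))

/-- On `[0,1]`, `f` is constant immediately to the right of, and immediately to the left of, every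
point. -/
def LocallyStep (f : ℝ → ℝ) : Prop :=
  (∀ t ∈ Ico (0 : ℝ) 1, ∃ b ∈ Ioc t 1, ∀ x ∈ Ico t b, f x = f t) ∧
  (∀ t ∈ Ioc (0 : ℝ) 1, ∃ a ∈ Ico (0 : ℝ) t, ∃ c, ∀ x ∈ Ioo a t, f x = c)

lemma exists_cell_right {t : ℕ → ℝ} {x : ℝ} {m : ℕ} (h0 : t 0 ≤ x) (hm : x < t m) :
    ∃ i < m, t i ≤ x ∧ x < t (i + 1) := by
  induction m with
  | zero => linarith
  | succ m ih =>
    rcases lt_or_ge x (t m) with h | h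
    · obtain ⟨i, hi, h'⟩ := ih h
      exact ⟨i, by omega, h'⟩
    · exact ⟨m, by omega, h, hm⟩

lemma exists_cell_left {t : ℕ → ℝ} {x : ℝ} {m : ℕ} (h0 : t 0 < x) (hm : x ≤ t m) :
    ∃ i < m, t i < x ∧ x ≤ t (i + 1) := by
  induction m with
  | zero => linarith
  | succ m ih =>
    rcases le_or_gt x (t m) with h | h
    · obtain ⟨i, hi, h'⟩ := ih h
      exact ⟨i, by omega, h'⟩
    · exact ⟨m, by omega, h, hm⟩

lemma PiecewiseConstant.locallyStep {f : ℝ → ℝ} (hf : PiecewiseConstant f) : LocallyStep f := by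
  obtain ⟨m, t, -, ht0, ht1, hlt, hc⟩ := hf
  have hmono : MonotoneOn t (Iic m) :=
    (strictMonoOn_Iic_of_lt_succ fun i hi => hlt i hi).monotoneOn
  constructor
  · intro x hx
    obtain ⟨i, hi, h1, h2⟩ := exists_cell_right (t := t) (ht0.le.trans hx.1) (ht1 ▸ hx.2)
    refine ⟨t (i + 1), ⟨h2, ?_⟩, fun y hy => hc i hi y ⟨h1.trans hy.1, hy.2⟩ x ⟨h1, h2⟩⟩
    exact ht1 ▸ hmono (mem_Iic.2 hi) (mem_Iic.2 le_rfl) hi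
  · intro x hx
    obtain ⟨i, hi, h1, h2⟩ := exists_cell_left (t := t) (ht0.trans_lt hx.1) (hx.2.trans ht1.ge)
    refine ⟨t i, ⟨?_, h1⟩, f (t i), fun y hy =>
      hc i hi y ⟨hy.1.le, hy.2.trans_le h2⟩ (t i) ⟨le_rfl, hlt i hi⟩⟩
    exact ht0 ▸ hmono (mem_Iic.2 (Nat.zero_le m)) (mem_Iic.2 hi.le) (Nat.zero_le i)

lemma LocallyStep.piecewiseConstant {f : ℝ → ℝ} (hf : LocallyStep f) : PiecewiseConstant f := by
  set P : ℝ → Prop := fun x => ∃ (m : ℕ) (t : ℕ → ℝ), t 0 = 0 ∧ t m = x ∧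
    (∀ i < m, t i < t (i + 1)) ∧
    ∀ i < m, ∀ s₁ ∈ Ico (t i) (t (i + 1)), ∀ s₂ ∈ Ico (t i) (t (i + 1)), f s₁ = f s₂ with hP
  have happend : ∀ x y c, x < y → P x → (∀ z ∈ Ico x y, f z = c) → P y := by
    rintro x y c hxy ⟨m, t, h0, hm, hlt, hc⟩ hcon
    have key : ∀ i < m + 1, i ≠ m → i + 1 ≤ m := fun i _ _ => by omega
    refine ⟨m + 1, fun i => if i ≤ m then t i else y, by simp [h0], by simp, ?_, ?_⟩
    · intro i hi
      by_cases him : i = m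
      · subst him; simpa [hm] using hxy
      · have := key i hi him
        simpa [this, (Nat.le_succ i).trans this] using hlt i this
    · intro i hi s₁ hs₁ s₂ hs₂
      by_cases him : i = m
      · subst him
        simp only [le_refl, if_true, hm, Nat.succ_le_iff, lt_irrefl, if_false] at hs₁ hs₂
        rw [hcon s₁ hs₁, hcon s₂ hs₂]
      · have := key i hi him
        simp only [this, (Nat.le_succ i).trans this, if_true] at hs₁ hs₂
        exact hc i this s₁ hs₁ s₂ hs₂
  set S := {x ∈ Icc (0 : ℝ) 1 | P x} with hS
  have h0 : (0 : ℝ) ∈ S := ⟨⟨le_rfl, zero_le_one⟩, 0, fun _ => 0, rfl, rfl, by simp, by simp⟩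
  have hb : BddAbove S := ⟨1, fun x hx => hx.1.2⟩
  have hc0 : 0 ≤ sSup S := le_csSup hb h0
  have hc1 : sSup S ≤ 1 := csSup_le ⟨0, h0⟩ fun x hx => hx.1.2
  have hPc : P (sSup S) := by
    rcases hc0.eq_or_lt with h | h
    · exact h ▸ h0.2
    obtain ⟨a, ha, c, hac⟩ := hf.2 _ ⟨h, hc1⟩
    obtain ⟨x, hx, hax⟩ := exists_lt_of_lt_csSup ⟨0, h0⟩ ha.2
    rcases (le_csSup hb hx).eq_or_lt with h' | h'
    · exact h' ▸ hx.2
    · exact happend x _ c h' hx.2 fun z hz => hac z ⟨hax.trans_le hz.1, hz.2⟩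
  have hone : sSup S = 1 := by
    by_contra hne
    obtain ⟨b, hb', hcb⟩ := hf.1 _ ⟨hc0, lt_of_le_of_ne hc1 hne⟩
    have : b ∈ S := ⟨⟨hc0.trans hb'.1.le, hb'.2⟩, happend _ b _ hb'.1 hPc hcb⟩
    exact absurd (le_csSup hb this) (not_le.2 hb'.1)
  obtain ⟨m, t, ht0, htm, hlt, hc⟩ := hone ▸ hPc
  refine ⟨m, t, Nat.pos_of_ne_zero fun h => ?_, ht0, htm, hlt, hc⟩
  subst h
  linarith

lemma LocallyStep.isCadlag {f : ℝ → ℝ} (hf : LocallyStep f) : IsCadlag f := by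
  constructor
  · intro t ht
    obtain ⟨b, hb, h⟩ := hf.1 t ht
    refine tendsto_const_nhds.congr' ?_
    filter_upwards [Ioo_mem_nhdsGT hb.1] with x hx
    exact (h x ⟨hx.1.le, hx.2⟩).symm
  · intro t ht
    obtain ⟨a, ha, c, h⟩ := hf.2 t ht
    refine ⟨c, tendsto_const_nhds.congr' ?_⟩
    filter_upwards [Ioo_mem_nhdsLT ha.2] with x hx
    exact (h x hx).symm

lemma LocallyStep.eq_of_no_disc {f : ℝ → ℝ} (hf : LocallyStep f) {a b : ℝ} (ha : 0 ≤ a)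
    (hab : a ≤ b) (hb : b ≤ 1) (hd : ∀ x ∈ Ioc a b, x ∉ Disc f) : f b = f a := by
  have hg := hf.isCadlag.rcll_extend
  have hsub : Icc a b ⊆ Icc 0 1 := Icc_subset_Icc ha hb
  have hcont : ContinuousOn (extend f) (Icc a b) := by
    intro x hx
    rcases hx.1.eq_or_lt with rfl | hax
    · exact (continuousWithinAt_Ioi_iff_Ici.1 (hg.right _)).mono Icc_subset_Ici_self
    · have h01 := hsub hx
      have hx' : f x = leftVal f x := by
        by_contra h
        exact hd x ⟨hax, hx.2⟩ ⟨h01, h⟩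
      refine ContinuousAt.continuousWithinAt ?_
      refine continuousAt_iff_continuous_left'_right'.2 ⟨?_, hg.right x⟩
      have := hg.left x
      rwa [← hf.isCadlag.leftVal_eq h01, ← hx', ← extend_of_mem f h01] at this
  have := constant_of_has_deriv_right_zero hcont (fun x hx => ?_) b ⟨hab, le_rfl⟩
  · rwa [extend_of_mem f (hsub ⟨hab, le_rfl⟩), extend_of_mem f (hsub ⟨le_rfl, hab⟩)] at this
  · have hx01 := hsub ⟨hx.1, hx.2.le⟩
    obtain ⟨c, hc, h⟩ := hf.1 x ⟨hx01.1, hx.2.trans_le hb⟩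
    refine (hasDerivWithinAt_const x (Ici x) (extend f x)).congr_of_eventuallyEq ?_ rfl
    filter_upwards [Ico_mem_nhdsGE hc.1] with y hy
    rw [extend_of_mem f hx01, extend_of_mem f ⟨hx01.1.trans hy.1, hy.2.le.trans hc.2⟩, h y hy]

/-- `g` changes value at least `k` times along some increasing sequence of points of `(-∞, t]`. -/
def Alternates (g : ℝ → ℝ) (k : ℕ) (t : ℝ) : Prop :=
  ∃ s : ℕ → ℝ, s k ≤ t ∧ ∀ i < k, s i < s (i + 1) ∧ g (s i) ≠ g (s (i + 1))

lemma not_alternates_of_mem_Dll {f : ℝ → ℝ} {j : ℕ} (hf : f ∈ Dll j) :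
    ¬ Alternates (extend f) j 1 := by
  rintro ⟨s, hs1, hs⟩
  obtain ⟨hpc, hfin, hcard⟩ := hf
  have hstep := hpc.locallyStep
  have hmono : StrictMonoOn s (Iic j) := strictMonoOn_Iic_of_lt_succ fun i hi => (hs i hi).1
  have hd : ∀ i < j, ∃ d ∈ Disc f, s i < d ∧ d ≤ s (i + 1) := by
    intro i hi
    by_contra! hno
    obtain ⟨hlt, hne⟩ := hs i hi
    have hle : s (i + 1) ≤ 1 :=
      (hmono.monotoneOn (mem_Iic.2 hi) (mem_Iic.2 le_rfl) hi).trans hs1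
    have hno' : ∀ x ∈ Ioc (s i) (s (i + 1)), x ∉ Disc f := fun x hx hxd =>
      absurd hx.2 (not_le.2 (hno x hxd hx.1))
    apply hne
    rcases lt_or_ge (s (i + 1)) 0 with h | h
    · rw [extend_of_neg f h, extend_of_neg f (hlt.trans h)]
    rcases lt_or_ge (s i) 0 with h' | h'
    · have h0 : f 0 = 0 := by
        by_contra h0
        exact hno' 0 ⟨h', h⟩ ⟨⟨le_rfl, zero_le_one⟩, by simpa [leftVal] using h0⟩
      rw [extend_of_neg f h', extend_of_mem f ⟨h, hle⟩, hstep.eq_of_no_disc le_rfl h hle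
        fun x hx => hno' x ⟨h'.trans hx.1, hx.2⟩, h0]
    · rw [extend_of_mem f ⟨h, hle⟩, extend_of_mem f ⟨h', hlt.le.trans hle⟩,
        hstep.eq_of_no_disc h' hlt.le hle hno']
  choose! d hdD hd1 hd2 using hd
  have hdlt : ∀ i < j, ∀ k < j, i < k → d i < d k := fun i hi k hk hik =>
    ((hd2 i hi).trans (hmono.monotoneOn (mem_Iic.2 hi) (mem_Iic.2 hk.le) hik)).trans_lt (hd1 k hk)
  have := Set.ncard_le_ncard_of_injOn (s := Iio j) d (fun i hi => hdD i hi) (fun i hi k hk h => by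
    rcases lt_trichotomy i k with h' | h' | h'
    · exact absurd h (hdlt i hi k hk h').ne
    · exact h'
    · exact absurd h (hdlt k hk i hi h').ne') hfin
  rw [← Finset.coe_range, Set.ncard_coe_finset, Finset.card_range] at this
  omega

lemma mem_Dll_of_not_alternates {f : ℝ → ℝ} {j : ℕ} (hf : IsCadlag f)
    (hno : ¬ Alternates (extend f) j 1) : f ∈ Dll j := by
  classical
  set g := extend f with hgdef
  have hg : RCLL g := hf.rcll_extend
  have hmonoA : ∀ k s t, s ≤ t → Alternates g k s → Alternates g k t :=
    fun k s t hst ⟨c, hc, h⟩ => ⟨c, hc.trans hst, h⟩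
  have hzero : ∀ t, Alternates g 0 t := fun t => ⟨fun _ => t, le_rfl, by simp⟩
  have hj : 0 < j := Nat.pos_of_ne_zero fun h => hno (h ▸ hzero 1)
  -- the maximal number of changes of value up to time `t`
  set N : ℝ → ℕ := fun t => Nat.findGreatest (fun k => Alternates g k t) j with hN
  have hNspec : ∀ t, Alternates g (N t) t := fun t =>
    Nat.findGreatest_spec (P := fun k => Alternates g k t) (Nat.zero_le j) (hzero t)
  have hNle : ∀ t, N t ≤ j := fun t => Nat.findGreatest_le j
  have hNge : ∀ t k, k ≤ j → Alternates g k t → k ≤ N t := fun t k hk h =>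
    Nat.le_findGreatest hk h
  have hNlt : ∀ t ≤ 1, N t < j := fun t ht => lt_of_le_of_ne (hNle t) fun h =>
    hno (hmonoA j t 1 ht (h ▸ hNspec t))
  have hNmono : Monotone N := fun s t hst => hNge t _ (hNle s) (hmonoA _ s t hst (hNspec s))
  have hconst : ∀ s t, s ≤ t → t ≤ 1 → N s = N t → g s = g t := by
    intro s t hst ht hNst
    obtain ⟨c, hc, hcs⟩ := hNspec s
    have key : ∀ t', s ≤ t' → t' ≤ 1 → N s = N t' → g (c (N s)) = g t' := by
      intro t' hst' ht' hNst'
      by_contra hne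
      have hlt : c (N s) < t' := lt_of_le_of_ne (hc.trans hst') fun h => hne (by rw [h])
      have : Alternates g (N s + 1) t' := by
        refine ⟨fun i => if i ≤ N s then c i else t', by simp, fun i hi => ?_⟩
        by_cases him : i = N s
        · subst him; simpa using ⟨hlt, hne⟩
        · have h1 : i + 1 ≤ N s := by omega
          simpa [h1, (Nat.le_succ i).trans h1] using hcs i h1
      have := hNge t' _ (hNlt s (hst.trans ht)) this
      omega
    rw [← key s le_rfl (hst.trans ht) rfl, key t hst ht hNst]
  have hstep : LocallyStep f := by
    constructor
    · intro t ht
      have hex : ∃ n, ∃ y ∈ Ioc t 1, N y = n := ⟨_, 1, ⟨ht.2, le_rfl⟩, rfl⟩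
      obtain ⟨y, hy, hyn⟩ := Nat.find_spec hex
      have heq : ∀ x ∈ Ioc t y, g x = g y := fun x hx =>
        hconst x y hx.2 hy.2 (le_antisymm (hNmono hx.2)
          (hyn ▸ Nat.find_min' hex ⟨x, ⟨hx.1, hx.2.trans hy.2⟩, rfl⟩))
      have hty : g t = g y := by
        refine tendsto_nhds_unique (hg.right t) (tendsto_const_nhds.congr' ?_)
        filter_upwards [Ioc_mem_nhdsGT hy.1] with x hx
        exact (heq x hx).symm
      refine ⟨y, hy, fun x hx => ?_⟩
      rw [← extend_of_mem f ⟨ht.1.trans hx.1, hx.2.le.trans hy.2⟩,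
        ← extend_of_mem f ⟨ht.1, ht.2.le⟩, ← hgdef, hty]
      rcases hx.1.eq_or_lt with rfl | h
      · exact hty
      · exact heq x ⟨h, hx.2.le⟩
    · intro t ht
      have hex : ∃ n, ∃ y ∈ Ico 0 t, j - N y = n := ⟨_, 0, ⟨le_rfl, ht.1⟩, rfl⟩
      obtain ⟨y, hy, hyn⟩ := Nat.find_spec hex
      refine ⟨y, hy, g y, fun x hx => ?_⟩
      rw [← extend_of_mem f ⟨hy.1.trans hx.1.le, hx.2.le.trans ht.2⟩]
      refine (hconst y x hx.1.le (hx.2.le.trans ht.2) ?_).symm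
      have h1 := Nat.find_min' hex ⟨x, ⟨hy.1.trans hx.1.le, hx.2⟩, rfl⟩
      have h2 := hNmono hx.1.le
      have h3 := hNle x
      omega
  have hdisc : ∀ t ∈ Disc f, ∀ s < t, N s < N t := by
    intro t ht s hst
    refine lt_of_le_of_ne (hNmono hst.le) fun h => ht.2 ?_
    have hc : ∀ x ∈ Ico s t, g x = g t := fun x hx =>
      hconst x t hx.2.le ht.1.2 (le_antisymm (hNmono hx.2.le) (h ▸ hNmono hx.1))
    rw [hf.leftVal_eq ht.1, ← extend_of_mem f ht.1]
    refine tendsto_nhds_unique (tendsto_const_nhds.congr' ?_) (hg.left t)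
    filter_upwards [Ico_mem_nhdsLT hst] with x hx
    exact (hc x hx).symm
  have hmaps : ∀ t ∈ Disc f, N t ∈ Ico 1 j := fun t ht =>
    ⟨Nat.one_le_iff_ne_zero.2 (Nat.ne_zero_of_lt (hdisc t ht (t - 1) (by linarith))),
      hNlt t ht.1.2⟩
  have hinj : InjOn N (Disc f) := fun s hs t ht h => by
    rcases lt_trichotomy s t with h' | h' | h'
    · exact absurd h (hdisc t ht s h').ne
    · exact h'
    · exact absurd h (hdisc s hs t h').ne'
  refine ⟨hstep.piecewiseConstant, Set.Finite.of_injOn hmaps hinj (Set.finite_Ico 1 j), ?_⟩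
  have := Set.ncard_le_ncard_of_injOn N hmaps hinj (Set.finite_Ico 1 j)
  rw [← Finset.coe_Ico, Set.ncard_coe_finset, Nat.card_Ico] at this
  omega

lemma bddAbove_range_abs_sub {u v : ℝ → ℝ} (hu : ContinuousOn u (Icc 0 1))
    (hv : ContinuousOn v (Icc 0 1)) :
    BddAbove (range fun s : Icc (0 : ℝ) 1 => |u s - v s|) := by
  have := isCompact_Icc.bddAbove_image (hu.sub hv).abs
  rwa [image_eq_range] at this

lemma exists_close_paramRep {f ζ : ℝ → ℝ} (hf : IsCadlag f) (hζ : IsCadlag ζ) {ε : ℝ}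
    (h : dM1 f ζ < ε) : ∃ u₁ v₁ u₂ v₂ : ℝ → ℝ, ParamRep f u₁ v₁ ∧ ParamRep ζ u₂ v₂ ∧
      ∀ r ∈ Icc (0 : ℝ) 1, |u₁ r - u₂ r| < ε ∧ |v₁ r - v₂ r| < ε := by
  obtain ⟨u, v, huv⟩ := hf.exists_paramRep
  obtain ⟨u', v', huv'⟩ := hζ.exists_paramRep
  rw [dM1] at h
  obtain ⟨_, ⟨u₁, v₁, u₂, v₂, h₁, h₂, rfl⟩, hlt⟩ :=
    exists_lt_of_csInf_lt (by exact ⟨_, u, v, u', v', huv, huv', rfl⟩) h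
  refine ⟨u₁, v₁, u₂, v₂, h₁, h₂, fun r hr => ⟨?_, ?_⟩⟩
  · exact (le_ciSup (bddAbove_range_abs_sub h₁.1 h₂.1) ⟨r, hr⟩).trans_lt
      ((le_max_left _ _).trans_lt hlt)
  · exact (le_ciSup (bddAbove_range_abs_sub h₁.2.1 h₂.2.1) ⟨r, hr⟩).trans_lt
      ((le_max_right _ _).trans_lt hlt)

lemma ParamRep.mem_extGraph {f u v : ℝ → ℝ} (h : ParamRep f u v) {r : ℝ}
    (hr : r ∈ Icc (0 : ℝ) 1) : (u r, v r) ∈ extGraph f :=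
  h.2.2.1 ▸ mem_image_of_mem _ hr

lemma ParamRep.exists_eq {f u v : ℝ → ℝ} (h : ParamRep f u v) {t : ℝ}
    (ht : t ∈ Icc (0 : ℝ) 1) : ∃ r ∈ Icc (0 : ℝ) 1, u r = f t ∧ v r = t := by
  have : (f t, t) ∈ extGraph f := ⟨ht, min_le_right _ _, le_max_right _ _⟩
  rw [← h.2.2.1] at this
  obtain ⟨r, hr, hrt⟩ := this
  exact ⟨r, hr, Prod.mk.inj hrt⟩

lemma ParamRep.apply_one {f u v : ℝ → ℝ} (h : ParamRep f u v) : u 1 = f 1 := by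
  have h1 : (1 : ℝ) ∈ Icc (0 : ℝ) 1 := ⟨zero_le_one, le_rfl⟩
  obtain ⟨r, hr, hur, hvr⟩ := h.exists_eq h1
  obtain ⟨hv1, hu1⟩ := h.mem_extGraph h1
  simp only at hv1 hu1
  rcases h.2.2.2 r hr 1 h1 hr.2 with hlt | ⟨heq, hle⟩
  · linarith [hv1.2]
  rw [← heq, hvr] at hu1 hle
  rw [hur] at hle
  rcases le_total (leftVal f 1) (f 1) with hc | hc
  · rw [min_eq_left hc, max_eq_right hc] at hu1
    rw [abs_of_nonpos (by linarith), abs_of_nonpos (by linarith [hu1.1])] at hle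
    linarith [hu1.2]
  · rw [min_eq_right hc, max_eq_left hc] at hu1
    rw [abs_of_nonneg (by linarith), abs_of_nonneg (by linarith [hu1.2])] at hle
    linarith [hu1.1]

section Limit

variable {ξ : ℕ → ℝ → ℝ} {ζ : ℝ → ℝ}

lemma eventually_abs_apply_one_sub_lt (hξ : ∀ n, IsCadlag (ξ n)) (hζ : IsCadlag ζ)
    (hconv : Tendsto (fun n => dM1 (ξ n) ζ) atTop (𝓝 0)) {ε : ℝ} (hε : 0 < ε) :
    ∀ᶠ n in atTop, |ξ n 1 - ζ 1| < ε := by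
  filter_upwards [hconv.eventually (Iio_mem_nhds hε)] with n hn
  obtain ⟨u₁, v₁, u₂, v₂, h₁, h₂, hcl⟩ := exists_close_paramRep (hξ n) hζ hn
  have := (hcl 1 ⟨zero_le_one, le_rfl⟩).1
  rwa [h₁.apply_one, h₂.apply_one] at this

/-- Near `t`, to the right of it, convergence in `dM1` controls the values by `ζ t`. -/
lemma eventually_abs_sub_lt_right (hξ : ∀ n, IsCadlag (ξ n)) (hζ : IsCadlag ζ)
    (hconv : Tendsto (fun n => dM1 (ξ n) ζ) atTop (𝓝 0)) {t : ℝ} (ht : t ∈ Ico (0 : ℝ) 1)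
    {ε : ℝ} (hε : 0 < ε) :
    ∃ h > 0, ∀ s ∈ Ioo t (t + h), s ≤ 1 → ∀ᶠ n in atTop, |ξ n s - ζ t| < ε := by
  have hg := hζ.rcll_extend
  obtain ⟨h, hh, hr⟩ := hg.exists_right t (half_pos hε)
  refine ⟨h, hh, fun s hs hs1 => ?_⟩
  have hs01 : s ∈ Icc (0 : ℝ) 1 := ⟨ht.1.trans hs.1.le, hs1⟩
  set e := min (ε / 2) (min (s - t) (t + h - s)) with he
  have he0 : 0 < e := lt_min (half_pos hε) (lt_min (sub_pos.2 hs.1) (sub_pos.2 hs.2))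
  have he1 : e ≤ ε / 2 := min_le_left _ _
  have he2 : e ≤ s - t := (min_le_right _ _).trans (min_le_left _ _)
  have he3 : e ≤ t + h - s := (min_le_right _ _).trans (min_le_right _ _)
  filter_upwards [hconv.eventually (Iio_mem_nhds he0)] with n hn
  obtain ⟨u₁, v₁, u₂, v₂, h₁, h₂, hcl⟩ := exists_close_paramRep (hξ n) hζ hn
  obtain ⟨r, hr', hur, hvr⟩ := h₁.exists_eq hs01
  obtain ⟨hc1, hc2⟩ := hcl r hr'
  rw [hur] at hc1
  rw [hvr, abs_lt] at hc2
  obtain ⟨hv, hu⟩ := h₂.mem_extGraph hr'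
  simp only at hv hu
  rw [hζ.leftVal_eq hv, ← extend_of_mem ζ hv] at hu
  have := hg.uIcc_subset hr (t := v₂ r) ⟨by linarith [hc2.2], by linarith [hc2.1]⟩ hu
  rw [extend_of_mem ζ ⟨ht.1, ht.2.le⟩] at this
  rw [abs_lt] at hc1 ⊢
  exact ⟨by linarith [hc1.1, this.1], by linarith [hc1.2, this.2]⟩

lemma exists_near_eventually_close {η : ℕ → ℝ → ℝ} {ζ' : ℝ → ℝ} {z : ℝ}
    (hξη : ∀ n t, ξ n t = z * t + η n t) (hζζ' : ∀ t, ζ t = z * t + ζ' t)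
    (hξ : ∀ n, IsCadlag (ξ n)) (hζ : IsCadlag ζ)
    (hconv : Tendsto (fun n => dM1 (ξ n) ζ) atTop (𝓝 0)) {t : ℝ} (ht : t ≤ 1) {δ h : ℝ}
    (hδ : 0 < δ) (hh : 0 < h) :
    ∃ s ∈ Ico t (t + h), s ≤ 1 ∧ ∀ᶠ n in atTop, |extend (η n) s - extend ζ' t| < δ := by
  rcases lt_or_ge t 0 with h0 | h0
  · exact ⟨t, ⟨le_rfl, by linarith⟩, ht, Eventually.of_forall fun n => by
      simpa [extend_of_neg _ h0] using hδ⟩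
  rcases ht.eq_or_lt with rfl | h1
  · refine ⟨1, ⟨le_rfl, by linarith⟩, le_rfl, ?_⟩
    filter_upwards [eventually_abs_apply_one_sub_lt hξ hζ hconv hδ] with n hn
    rw [hξη, hζζ', add_sub_add_left_eq_sub] at hn
    rwa [extend_of_mem _ ⟨h0, ht⟩, extend_of_mem _ ⟨h0, ht⟩]
  · obtain ⟨h', hh', hev⟩ := eventually_abs_sub_lt_right hξ hζ hconv ⟨h0, h1⟩ (half_pos hδ)
    have hz : 0 < |z| + 1 := by positivity
    set e := min (min h h') (min (1 - t) (δ / 2 / (|z| + 1))) / 2 with he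
    have hm : 0 < min (min h h') (min (1 - t) (δ / 2 / (|z| + 1))) :=
      lt_min (lt_min hh hh') (lt_min (sub_pos.2 h1) (by positivity))
    have he0 : 0 < e := half_pos hm
    have hem : e < min (min h h') (min (1 - t) (δ / 2 / (|z| + 1))) := half_lt_self hm
    simp only [lt_min_iff] at hem
    obtain ⟨⟨he1, he2⟩, he3, he4⟩ := hem
    rw [lt_div_iff₀ hz] at he4
    refine ⟨t + e, ⟨by linarith, by linarith⟩, by linarith, ?_⟩
    filter_upwards [hev (t + e) ⟨by linarith, by linarith⟩ (by linarith)] with n hn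
    rw [extend_of_mem _ ⟨by linarith, by linarith⟩, extend_of_mem _ ⟨h0, ht⟩]
    have h2 : η n (t + e) - ζ' t = (ξ n (t + e) - ζ t) - z * e := by
      rw [hξη, hζζ']; ring
    have h3 : |z * e| ≤ δ / 2 := by
      rw [abs_mul, abs_of_pos he0]; nlinarith
    rw [h2]
    linarith [abs_sub (ξ n (t + e) - ζ t) (z * e)]

/-- Alternation of a limit is inherited by the approximating functions. -/
lemma Alternates.exists_of_near {γ : ℕ → ℝ → ℝ} {g : ℝ → ℝ} {j : ℕ} (hg : Alternates g j 1)
    (hnear : ∀ t ≤ (1 : ℝ), ∀ δ > 0, ∀ h > 0,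
      ∃ s ∈ Ico t (t + h), s ≤ 1 ∧ ∀ᶠ n in atTop, |γ n s - g t| < δ) :
    ∃ n, Alternates (γ n) j 1 := by
  obtain ⟨s, hs1, hs⟩ := hg
  have hmono : StrictMonoOn s (Iic j) := strictMonoOn_Iic_of_lt_succ fun i hi => (hs i hi).1
  have hδ : ∀ᶠ δ : ℝ in 𝓝[>] 0, ∀ i ∈ Finset.range j, δ < |g (s i) - g (s (i + 1))| / 2 := by
    rw [Filter.eventually_all_finset]
    intro i hi
    refine nhdsWithin_le_nhds (Iio_mem_nhds (half_pos (abs_pos.2 (sub_ne_zero.2 ?_))))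
    exact (hs i (Finset.mem_range.1 hi)).2
  obtain ⟨δ, hδ, hδ0⟩ := (hδ.and self_mem_nhdsWithin).exists
  have hpt : ∀ i ≤ j, ∃ r, s i ≤ r ∧ (i < j → r < s (i + 1)) ∧ r ≤ 1 ∧
      ∀ᶠ n in atTop, |γ n r - g (s i)| < δ := by
    intro i hi
    have hsi : s i ≤ 1 := (hmono.monotoneOn (mem_Iic.2 hi) (mem_Iic.2 le_rfl) hi).trans hs1
    rcases hi.eq_or_lt with rfl | hij
    · obtain ⟨r, hr, hr1, hev⟩ := hnear (s i) hsi δ hδ0 1 one_pos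
      exact ⟨r, hr.1, fun h => absurd h (lt_irrefl _), hr1, hev⟩
    · obtain ⟨r, hr, hr1, hev⟩ := hnear (s i) hsi δ hδ0 _ (sub_pos.2 (hs i hij).1)
      exact ⟨r, hr.1, fun _ => by simpa using hr.2, hr1, hev⟩
  choose! r hr1 hr2 hr3 hr4 using hpt
  have hev : ∀ᶠ n in atTop, ∀ i ∈ Finset.range (j + 1), |γ n (r i) - g (s i)| < δ := by
    rw [Filter.eventually_all_finset]
    exact fun i hi => hr4 i (Nat.lt_succ_iff.1 (Finset.mem_range.1 hi))
  obtain ⟨n, hn⟩ := hev.exists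
  refine ⟨n, r, hr3 j le_rfl, fun i hi => ⟨(hr2 i hi.le hi).trans_le (hr1 (i + 1) hi), fun h => ?_⟩⟩
  have h1 := hn i (Finset.mem_range.2 (by omega))
  have h2 := hn (i + 1) (Finset.mem_range.2 (by omega))
  have h3 := hδ i (Finset.mem_range.2 hi)
  rw [← h] at h2
  rw [abs_sub_comm] at h1
  linarith [abs_sub_le (g (s i)) (γ n (r i)) (g (s (i + 1)))]

end Limit

lemma IsCadlag.add_linear {f : ℝ → ℝ} (hf : IsCadlag f) (z : ℝ) :
    IsCadlag fun t => z * t + f t := by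
  have hc : ∀ t, Tendsto (fun t : ℝ => z * t) (𝓝 t) (𝓝 (z * t)) := fun t =>
    (continuous_const_mul z).tendsto t
  refine ⟨fun t ht => ((hc t).mono_left nhdsWithin_le_nhds).add (hf.1 t ht), fun t ht => ?_⟩
  obtain ⟨l, hl⟩ := hf.2 t ht
  exact ⟨_, ((hc t).mono_left nhdsWithin_le_nhds).add hl⟩

/-- **Lemma (`lem: closeness of D_<<j`)**: for every `j ≥ 0` and `z ∈ ℝ`, the set
`D̲^z_{≪ j}` is (sequentially) closed in `(D[0,1], d_{M₁'})`. -/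
theorem DllZ_closed (j : ℕ) (z : ℝ) (ξ : ℕ → ℝ → ℝ) (ζ : ℝ → ℝ)
    (hmem : ∀ n, ξ n ∈ DllZ z j) (hζ : IsCadlag ζ)
    (hconv : Filter.Tendsto (fun n => dM1 (ξ n) ζ) Filter.atTop (nhds 0)) :
    ζ ∈ DllZ z j := by
  choose η hη hξη using hmem
  have hζ' : IsCadlag fun t => (-z) * t + ζ t := hζ.add_linear (-z)
  refine ⟨fun t => (-z) * t + ζ t, mem_Dll_of_not_alternates hζ' fun halt => ?_,
    by ext t; ring⟩
  have hξ : ∀ n, IsCadlag (ξ n) := fun n =>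
    hξη n ▸ (hη n).1.locallyStep.isCadlag.add_linear z
  obtain ⟨n, hn⟩ := halt.exists_of_near fun t ht δ hδ h hh =>
    exists_near_eventually_close (η := η) (z := z) (fun n t => by rw [hξη n])
      (fun t => by ring) hξ hζ hconv ht hδ hh
  exact not_alternates_of_mem_Dll (hη n) hn
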